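/- Let Φ ⊂ ℝ^d_0 be a simplex set and let τ, σ ∈ 𝒮 be permutation matrices with τ^{−1}σ ∉ ⟨θ⟩. Then there exist τ' ∈ 𝒮 and an integer 1 ≤ k ≤ n such that w_{τ'}^Φ + k(w_τ^Φ − w_σ^Φ) ∉ W_Φ + Δ_Φ. Moreover, if d is prime then for every τ' ∈ 𝒮 there exists such a k. -/

import Mathlib

open scoped Pointwise

noncomputable section

abbrev SLR (d : ℕ) := Matrix.SpecialLinearGroup (Fin d) ℝ

instance (d : ℕ) : TopologicalSpace (SLR d) := instTopologicalSpaceSubtype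

def Gamma (d : ℕ) : Subgroup (SLR d) :=
  (Matrix.SpecialLinearGroup.map (n := Fin d) (Int.castRingHom ℝ)).range

abbrev XSpace (d : ℕ) := SLR d ⧸ Gamma d

def latticeOf (d : ℕ) (x : XSpace d) : Set (Fin d → ℝ) :=
  {w | ∃ g : SLR d, (QuotientGroup.mk g : XSpace d) = x ∧
      ∃ v : Fin d → ℤ, w = (g : Matrix (Fin d) (Fin d) ℝ).mulVec fun i => (v i : ℝ)}

def shortest (d : ℕ) (x : XSpace d) : ℝ :=
  sInf {r | ∃ w ∈ latticeOf d x, w ≠ 0 ∧ r = ‖w‖}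

def aSL (d : ℕ) (t : Fin d → ℝ) (ht : ∑ i, t i = 0) : SLR d :=
  ⟨Matrix.diagonal fun i => Real.exp (t i), by
    rw [Matrix.det_diagonal, ← Real.exp_sum, ht, Real.exp_zero]⟩

def Aorbit (d : ℕ) (x : XSpace d) : Set (XSpace d) :=
  {y | ∃ (t : Fin d → ℝ) (ht : ∑ i, t i = 0), y = aSL d t ht • x}

def stdLat (d : ℕ) : XSpace d := QuotientGroup.mk 1

/-- The hyperplane `ℝ^d_0` of zero coordinate sum, as a set. -/
def V0 (d : ℕ) : Set (Fin d → ℝ) := {t | ∑ i, t i = 0}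

/-- The hyperplane `ℝ^d_0`, as a submodule. -/
def V0sub (d : ℕ) : Submodule ℝ (Fin d → ℝ) :=
  LinearMap.ker (∑ i : Fin d, LinearMap.proj i)

/-- A simplex set: `d` vectors in `ℝ^d_0` summing to zero and spanning `ℝ^d_0`. -/
structure SimplexSet (d : ℕ) where
  elems : Finset (Fin d → ℝ)
  card_eq : elems.card = d
  sum_eq_zero : elems.sum id = 0
  span_eq : Submodule.span ℝ (elems : Set (Fin d → ℝ)) = V0sub d

/-- The lattice `Δ_Φ` associated to a simplex set. -/
def latticeOfSS {d : ℕ} (Φ : SimplexSet d) : AddSubgroup (Fin d → ℝ) :=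
  AddSubgroup.closure (Φ.elems : Set (Fin d → ℝ))

/-- `⌈t⌉ = max_i t_i`. -/
def ceilMax {d : ℕ} (t : Fin d → ℝ) : ℝ := ⨆ i, t i

/-- `ξ_Φ = max_{t ∈ Φ} ⌈t⌉`. -/
def xi {d : ℕ} (Φ : SimplexSet d) : ℝ :=
  sSup (ceilMax '' (Φ.elems : Set (Fin d → ℝ)))

/-- Square root of the absolute Gram determinant of a `(d-1)`-tuple of vectors. -/
def gram (d : ℕ) (v : Fin (d - 1) → (Fin d → ℝ)) : ℝ :=
  Real.sqrt |(Matrix.of fun i j : Fin (d - 1) => ∑ k, v i k * v j k).det|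

/-- The (euclidean) covolume of the lattice generated by a set `S ⊆ ℝ^d_0` of rank `d-1`:
the common value of the Gram determinant over all `(d-1)`-tuples generating the same
subgroup as `S`. -/
def covolSet (d : ℕ) (S : Set (Fin d → ℝ)) : ℝ :=
  sInf {r | ∃ v : Fin (d - 1) → (Fin d → ℝ),
      AddSubgroup.closure (Set.range v) = AddSubgroup.closure S ∧ r = gram d v}

/-- The covolume `|Δ_Φ|`. -/
def covolSS {d : ℕ} (Φ : SimplexSet d) : ℝ := covolSet d (Φ.elems : Set (Fin d → ℝ))

/-- The set `φ(stab_{UA}(x))` of logarithmic stabilizer times. -/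
def stabSet (d : ℕ) (x : XSpace d) : Set (Fin d → ℝ) :=
  {t | (∑ i, t i = 0) ∧ ∃ ε : Fin d → ℝ, (∀ i, ε i = 1 ∨ ε i = -1) ∧
      (fun v => (Matrix.diagonal fun i => ε i * Real.exp (t i)).mulVec v) '' latticeOf d x
        = latticeOf d x}

/-- The lattice `Δ_x = φ(stab_{UA}(x))`. -/
def DeltaX (d : ℕ) (x : XSpace d) : AddSubgroup (Fin d → ℝ) :=
  AddSubgroup.closure (stabSet d x)

/-- The covolume `|Δ_x|`. -/
def covolX (d : ℕ) (x : XSpace d) : ℝ := covolSet d (stabSet d x)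

/-- `Φ` is an `M`-tight simplex set for `x`. -/
def IsTight (d : ℕ) (M : ℝ) (x : XSpace d) (Φ : SimplexSet d) : Prop :=
  (Φ.elems : Set (Fin d → ℝ)) ⊆ (DeltaX d x : Set (Fin d → ℝ)) ∧
  shortest d x ≤ M * Real.exp (-((d - 1 : ℝ) / 2) * xi Φ)

/-- `Ω_M`: points of `Ω` admitting an `M`-tight simplex set. -/
def OmegaM (d : ℕ) (M : ℝ) : Set (XSpace d) :=
  {x | IsCompact (Aorbit d x) ∧ ∃ Φ : SimplexSet d, IsTight d M x Φ}

/-- The standard simplex set vectors `b_j` (with `-(d-1)` in coordinate `j`, `1` elsewhere). -/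
def bstar (d : ℕ) (j : Fin d) : Fin d → ℝ := fun i => if i = j then -(d - 1 : ℝ) else 1

/-- The points `w_τ^{Φ_*} = τ(d⁻¹ ∑_ℓ (ℓ-1) b_ℓ)`. -/
def wStar (d : ℕ) (τ : Equiv.Perm (Fin d)) : Fin d → ℝ :=
  fun i => (d : ℝ)⁻¹ * ∑ ℓ : Fin d, (ℓ : ℝ) * bstar d ℓ (τ.symm i)

/-- `h` is a distortion map for `Φ`: a linear map with `h Φ_* = |Δ_Φ|^{-1/(d-1)} Φ`. -/
def IsDistortion {d : ℕ} (Φ : SimplexSet d) (h : (Fin d → ℝ) →ₗ[ℝ] (Fin d → ℝ)) : Prop :=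
  h '' Set.range (bstar d) =
    (fun v => (covolSS Φ) ^ (-(1 : ℝ) / (d - 1 : ℝ)) • v) '' (Φ.elems : Set (Fin d → ℝ))

/-- `w_τ^Φ = |Δ_Φ|^{1/(d-1)} h_Φ (w_τ^{Φ_*})`. -/
def wPhi {d : ℕ} (Φ : SimplexSet d) (h : (Fin d → ℝ) →ₗ[ℝ] (Fin d → ℝ))
    (τ : Equiv.Perm (Fin d)) : Fin d → ℝ :=
  (covolSS Φ) ^ ((1 : ℝ) / (d - 1 : ℝ)) • h (wStar d τ)

/-- `S'` is a set of representatives for the cosets `𝒮 / ⟨θ⟩`, `θ` the cyclic rotation. -/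
def IsRepSet (d : ℕ) (S' : Set (Equiv.Perm (Fin d))) : Prop :=
  ∀ τ : Equiv.Perm (Fin d), ∃! σ, σ ∈ S' ∧ τ⁻¹ * σ ∈ Subgroup.zpowers (finRotate d)

/-- The closed ball of radius `r` in `ℝ^d_0`. -/
def ballV0 (d : ℕ) (r : ℝ) : Set (Fin d → ℝ) := {t | (∑ i, t i = 0) ∧ ‖t‖ ≤ r}

/-- Operator norm of a matrix with respect to the supremum norm. -/
def opNorm (d : ℕ) (g : Matrix (Fin d) (Fin d) ℝ) : ℝ :=
  sSup {r | ∃ v : Fin d → ℝ, ‖v‖ ≤ 1 ∧ r = ‖g.mulVec v‖}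

/-- Operator norm of a linear map restricted to the hyperplane `ℝ^d_0`. -/
def normOnV0 (d : ℕ) (h : (Fin d → ℝ) →ₗ[ℝ] (Fin d → ℝ)) : ℝ :=
  sSup {r | ∃ v : Fin d → ℝ, (∑ i, v i = 0) ∧ ‖v‖ ≤ 1 ∧ r = ‖h v‖}

/-- `Ω_M(ε, C)`. -/
def OmegaMEC (d : ℕ) (M ε C : ℝ) : Set (XSpace d) :=
  {x | IsCompact (Aorbit d x) ∧ ∃ Φ : SimplexSet d, IsTight d M x Φ ∧
    ∃ h, IsDistortion Φ h ∧
      ∀ τ : Equiv.Perm (Fin d), ∃ (hw : ∑ i, wPhi Φ h τ i = 0)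
        (g : SLR d) (s : Fin d → ℝ) (hs : ∑ i, s i = 0),
        opNorm d ((g : Matrix (Fin d) (Fin d) ℝ) - 1) ≤ C * Real.exp (-(covolX d x) ^ ε) ∧
        aSL d (wPhi Φ h τ) hw • x = (g * aSL d s hs) • stdLat d}

/-- Homothety–`GL(ℤ)` equivalence of `(d-1)`-tuples: same lattice shape. -/
def shapeRel (d : ℕ) (v w : Fin (d - 1) → (Fin d → ℝ)) : Prop :=
  ∃ c : ℝ, 0 < c ∧ ∃ g : Matrix (Fin (d - 1)) (Fin (d - 1)) ℤ, IsUnit g.det ∧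
    ∀ i, w i = c • ∑ j, ((g i j : ℝ) • v j)

/-- The space of shapes of lattices in `ℝ^d_0` (with the quotient topology). -/
def ShapeSpace (d : ℕ) := Quot (shapeRel d)

instance (d : ℕ) : TopologicalSpace (ShapeSpace d) :=
  instTopologicalSpaceQuot

/-- The shape of the lattice generated by a tuple. -/
def shapeOf (d : ℕ) (v : Fin (d - 1) → (Fin d → ℝ)) : ShapeSpace d := Quot.mk _ v

/-- An enumeration of the elements of a simplex set. -/
def ssEnum {d : ℕ} (Φ : SimplexSet d) : Fin d → (Fin d → ℝ) :=
  fun i => ((Φ.elems.equivFin.symm (finCongr Φ.card_eq.symm i)) : Fin d → ℝ)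

/-- The shape of `Δ_Φ` (generated by the first `d-1` elements of `Φ`). -/
def shapeOfSS {d : ℕ} (Φ : SimplexSet d) : ShapeSpace d :=
  shapeOf d fun i : Fin (d - 1) => ssEnum Φ (Fin.castLE (Nat.sub_le d 1) i)

/-- `Ω_{M,K}`. -/
def OmegaMK (d : ℕ) (M : ℝ) (K : Set (ShapeSpace d)) : Set (XSpace d) :=
  {x | IsCompact (Aorbit d x) ∧ ∃ Φ : SimplexSet d, IsTight d M x Φ ∧ shapeOfSS Φ ∈ K}

theorem exists_int_matrix_of_mem_closure {m ι : Type*} [Fintype m] {u v : m → ι → ℝ}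
    (huv : ∀ i, u i ∈ AddSubgroup.closure (Set.range v)) :
    ∃ A : Matrix m m ℤ, Matrix.of u = A.map (Int.castRingHom ℝ) * Matrix.of v := by
  have key : ∀ i, ∃ c : m → ℤ, u i = ∑ j, c j • v j := by
    intro i
    have hi := huv i
    rw [← Submodule.span_int_eq_addSubgroupClosure] at hi
    obtain ⟨c, hc⟩ := (Submodule.mem_span_range_iff_exists_fun ℤ).1 hi
    exact ⟨c, hc.symm⟩
  choose A hA using key
  refine ⟨Matrix.of A, ?_⟩
  ext i k
  simp [hA, Matrix.mul_apply]

theorem gram_eq_sqrt (d : ℕ) (v : Fin (d - 1) → (Fin d → ℝ)) :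
    gram d v = Real.sqrt |(Matrix.of v * (Matrix.of v).transpose).det| := by
  unfold gram
  congr 3

theorem gram_le_gram {d : ℕ} {u v : Fin (d - 1) → (Fin d → ℝ)}
    (huv : AddSubgroup.closure (Set.range u) = AddSubgroup.closure (Set.range v))
    (hv : gram d v ≠ 0) : gram d v ≤ gram d u := by
  obtain ⟨A, hA⟩ := exists_int_matrix_of_mem_closure (u := u) (v := v)
    fun i => huv ▸ AddSubgroup.subset_closure ⟨i, rfl⟩
  obtain ⟨B, hB⟩ := exists_int_matrix_of_mem_closure (u := v) (v := u)
    fun i => huv ▸ AddSubgroup.subset_closure ⟨i, rfl⟩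
  have det_gram : ∀ (C : Matrix (Fin (d - 1)) (Fin (d - 1)) ℤ) (x y : Fin (d - 1) → (Fin d → ℝ)),
      Matrix.of x = C.map (Int.castRingHom ℝ) * Matrix.of y →
      (Matrix.of x * (Matrix.of x).transpose).det
        = (C.det : ℝ) ^ 2 * (Matrix.of y * (Matrix.of y).transpose).det := by
    intro C x y hxy
    have hC : (C.map (Int.castRingHom ℝ)).det = (C.det : ℝ) := by
      have := (Int.castRingHom ℝ).map_det C
      simpa using this.symm
    rw [hxy, Matrix.transpose_mul, Matrix.mul_assoc, ← Matrix.mul_assoc (Matrix.of y),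
      Matrix.det_mul, Matrix.det_mul, Matrix.det_transpose, hC]
    ring
  have h1 := det_gram A u v hA
  have h2 := det_gram B v u hB
  rw [gram_eq_sqrt] at hv
  have hdet : (Matrix.of v * (Matrix.of v).transpose).det ≠ 0 := fun h0 => hv (by simp [h0])
  have hA0 : A.det ≠ 0 := by
    rintro h0
    apply hdet
    rw [h2, h1, h0]
    simp
  have hA1 : (1 : ℝ) ≤ (A.det : ℝ) ^ 2 := by
    have : (1 : ℤ) ≤ A.det ^ 2 := by have := sq_pos_of_ne_zero hA0; omega
    exact_mod_cast this
  rw [gram_eq_sqrt, gram_eq_sqrt]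
  apply Real.sqrt_le_sqrt
  rw [h1, abs_mul, abs_of_nonneg (sq_nonneg (A.det : ℝ))]
  exact le_mul_of_one_le_left (abs_nonneg _) hA1

theorem gram_pos {d : ℕ} {v : Fin (d - 1) → (Fin d → ℝ)} (hv : LinearIndependent ℝ v) :
    0 < gram d v := by
  rw [gram_eq_sqrt, Real.sqrt_pos, abs_pos]
  have h1 : Function.Injective (Matrix.of v).vecMul :=
    Matrix.vecMul_injective_iff.2 hv
  have h2 := Matrix.PosDef.mul_conjTranspose_self (Matrix.of v) h1
  rw [Matrix.conjTranspose_eq_transpose_of_trivial] at h2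
  exact h2.det_pos.ne'

theorem finrank_V0sub (n : ℕ) : Module.finrank ℝ (V0sub (n + 1)) = n := by
  have hne : (∑ i : Fin (n + 1), LinearMap.proj i : (Fin (n + 1) → ℝ) →ₗ[ℝ] ℝ) ≠ 0 := by
    intro h0
    have := LinearMap.congr_fun h0 (Pi.single 0 1)
    simp [LinearMap.sum_apply, Pi.single_apply] at this
  have := Module.Dual.finrank_ker_add_one_of_ne_zero
    (f := (∑ i : Fin (n + 1), LinearMap.proj i : (Fin (n + 1) → ℝ) →ₗ[ℝ] ℝ)) hne
  simp only [Module.finrank_fintype_fun_eq_card, Fintype.card_fin] at this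
  unfold V0sub
  omega

theorem mem_V0sub {d : ℕ} {x : Fin d → ℝ} : x ∈ V0sub d ↔ ∑ i, x i = 0 := by
  simp [V0sub, LinearMap.sum_apply]

theorem range_ssEnum {d : ℕ} (Φ : SimplexSet d) : Set.range (ssEnum Φ) = Φ.elems := by
  ext x
  constructor
  · rintro ⟨i, rfl⟩
    exact Subtype.coe_prop _
  · intro hx
    exact ⟨finCongr Φ.card_eq (Φ.elems.equivFin ⟨x, hx⟩), by simp [ssEnum]⟩

theorem sum_ssEnum {d : ℕ} (Φ : SimplexSet d) : ∑ i, ssEnum Φ i = 0 := by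
  rw [← Φ.sum_eq_zero, ← Finset.sum_coe_sort Φ.elems]
  exact ((finCongr Φ.card_eq.symm).trans Φ.elems.equivFin.symm).sum_comp
    fun x : Φ.elems => (x : Fin d → ℝ)

theorem closure_range_castSucc_ssEnum {n : ℕ} (Φ : SimplexSet (n + 1)) :
    AddSubgroup.closure (Set.range fun i : Fin n => ssEnum Φ i.castSucc)
      = AddSubgroup.closure (Φ.elems : Set (Fin (n + 1) → ℝ)) := by
  rw [← range_ssEnum]
  apply le_antisymm
  · apply AddSubgroup.closure_mono
    rintro _ ⟨i, rfl⟩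
    exact ⟨_, rfl⟩
  · rw [AddSubgroup.closure_le]
    rintro _ ⟨i, rfl⟩
    induction i using Fin.lastCases with
    | cast i => exact AddSubgroup.subset_closure ⟨i, rfl⟩
    | last =>
      have h0 := sum_ssEnum Φ
      rw [Fin.sum_univ_castSucc] at h0
      rw [eq_neg_of_add_eq_zero_right h0]
      exact neg_mem (sum_mem fun i _ => AddSubgroup.subset_closure ⟨i, rfl⟩)

theorem linearIndependent_castSucc_ssEnum {n : ℕ} (Φ : SimplexSet (n + 1)) :
    LinearIndependent ℝ fun i : Fin n => ssEnum Φ i.castSucc := by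
  have hspan : Submodule.span ℝ (Set.range fun i : Fin n => ssEnum Φ i.castSucc)
      = V0sub (n + 1) := by
    have hc := closure_range_castSucc_ssEnum Φ
    rw [← Φ.span_eq]
    apply le_antisymm
    · rw [← range_ssEnum]
      apply Submodule.span_mono
      rintro _ ⟨i, rfl⟩
      exact ⟨_, rfl⟩
    · rw [Submodule.span_le]
      intro x hx
      have hx' : x ∈ AddSubgroup.closure (Set.range fun i : Fin n => ssEnum Φ i.castSucc) :=
        hc ▸ AddSubgroup.subset_closure hx
      have hle : AddSubgroup.closure (Set.range fun i : Fin n => ssEnum Φ i.castSucc) ≤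
          (Submodule.span ℝ
            (Set.range fun i : Fin n => ssEnum Φ i.castSucc)).toAddSubgroup := by
        rw [AddSubgroup.closure_le]
        exact Submodule.subset_span
      exact hle hx'
  rw [linearIndependent_iff_card_eq_finrank_span, Set.finrank, hspan, finrank_V0sub,
    Fintype.card_fin]

theorem covolSS_pos {n : ℕ} (Φ : SimplexSet (n + 1)) : 0 < covolSS Φ := by
  set v : Fin (n + 1 - 1) → (Fin (n + 1) → ℝ) := fun i : Fin n => ssEnum Φ i.castSucc
  have hpos : 0 < gram (n + 1) v := gram_pos (linearIndependent_castSucc_ssEnum Φ)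
  have hcl := closure_range_castSucc_ssEnum Φ
  refine hpos.trans_le (le_csInf ⟨_, v, hcl, rfl⟩ ?_)
  rintro _ ⟨w, hw, rfl⟩
  exact gram_le_gram (hw.trans hcl.symm) hpos.ne'

/-- The rescaled distortion map carries `Φ_*` to `Φ`. -/
theorem IsDistortion.image_smul {n : ℕ} {Φ : SimplexSet (n + 1)}
    {h : (Fin (n + 1) → ℝ) →ₗ[ℝ] (Fin (n + 1) → ℝ)} (hh : IsDistortion Φ h) :
    (covolSS Φ ^ ((1 : ℝ) / ((n + 1 : ℕ) - 1 : ℝ)) • h) '' Set.range (bstar (n + 1))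
      = Φ.elems := by
  have hc := covolSS_pos Φ
  unfold IsDistortion at hh
  have : (covolSS Φ ^ ((1 : ℝ) / ((n + 1 : ℕ) - 1 : ℝ)) • h) '' Set.range (bstar (n + 1))
      = (fun v => covolSS Φ ^ ((1 : ℝ) / ((n + 1 : ℕ) - 1 : ℝ)) • v) ''
        (h '' Set.range (bstar (n + 1))) := by
    rw [Set.image_image]
    rfl
  rw [this, hh, Set.image_image]
  simp only [smul_smul]
  rw [← Real.rpow_add hc, ← add_div]
  simp

theorem bstar_mem_V0sub {d : ℕ} (j : Fin d) : bstar d j ∈ V0sub d := by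
  rw [mem_V0sub]
  have : ∀ i, bstar d j i = 1 - (if i = j then (d : ℝ) else 0) := by
    intro i
    unfold bstar
    split_ifs <;> ring
  simp [this]

theorem wStar_apply {d : ℕ} (hd : d ≠ 0) (τ : Equiv.Perm (Fin d)) (i : Fin d) :
    wStar d τ i = (d : ℝ)⁻¹ * ∑ l : Fin d, (l : ℝ) - ((τ.symm i : ℕ) : ℝ) := by
  have : ∀ l : Fin d, (l : ℝ) * bstar d l (τ.symm i)
      = (l : ℝ) - (if τ.symm i = l then (d : ℝ) * l else 0) := by
    intro l
    unfold bstar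
    split_ifs <;> ring
  have hd_cast : (d : ℝ) ≠ 0 := by exact_mod_cast hd
  simp only [wStar, this, Finset.sum_sub_distrib]
  simp
  field_simp

theorem wStar_mem_V0sub {d : ℕ} (hd : d ≠ 0) (τ : Equiv.Perm (Fin d)) : wStar d τ ∈ V0sub d := by
  rw [mem_V0sub]
  simp only [wStar_apply hd, Finset.sum_sub_distrib]
  rw [τ.symm.sum_comp fun j : Fin d => ((j : ℕ) : ℝ)]
  have hd_cast : (d : ℝ) ≠ 0 := by exact_mod_cast hd
  simp [hd_cast]

/-- A linear map carrying `Φ_*` onto a simplex set is injective on the hyperplane `ℝ^d_0`. -/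
theorem injOn_V0sub_of_image_eq {n : ℕ} {Φ : SimplexSet (n + 1)}
    {H : (Fin (n + 1) → ℝ) →ₗ[ℝ] (Fin (n + 1) → ℝ)}
    (hH : H '' Set.range (bstar (n + 1)) = Φ.elems) :
    Set.InjOn H (V0sub (n + 1)) := by
  have hmap : (Submodule.span ℝ (Set.range (bstar (n + 1)))).map H = V0sub (n + 1) := by
    rw [Submodule.map_span, hH, Φ.span_eq]
  have hle : Submodule.span ℝ (Set.range (bstar (n + 1))) ≤ V0sub (n + 1) := by
    rw [Submodule.span_le]
    rintro _ ⟨j, rfl⟩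
    exact bstar_mem_V0sub j
  have hspan : Submodule.span ℝ (Set.range (bstar (n + 1))) = V0sub (n + 1) := by
    apply Submodule.eq_of_le_of_finrank_le hle
    conv_lhs => rw [← hmap]
    exact Submodule.finrank_map_le H _
  rw [hspan] at hmap
  have hmaps : ∀ x ∈ V0sub (n + 1), H x ∈ V0sub (n + 1) := fun x hx => by
    have := Submodule.mem_map_of_mem (f := H) hx
    rwa [hmap] at this
  refine (LinearMap.injOn_iff_surjOn hmaps).2 ?_
  intro y hy
  rw [SetLike.mem_coe, ← hmap] at hy
  exact hy

/-- The coordinates of a vector of `Δ_{Φ_*}` are integers congruent to each other modulo `d`. -/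
theorem exists_int_of_mem_closure_bstar {d : ℕ} {x : Fin d → ℝ}
    (hx : x ∈ AddSubgroup.closure (Set.range (bstar d))) :
    ∃ (s : ℤ) (m : Fin d → ℤ), ∀ i, x i = s - d * m i := by
  induction hx using AddSubgroup.closure_induction with
  | mem x hx =>
    obtain ⟨j, rfl⟩ := hx
    refine ⟨1, fun i => if i = j then 1 else 0, fun i => ?_⟩
    simp only [bstar]
    split_ifs <;> simp
  | zero => exact ⟨0, 0, by simp⟩
  | add x y _ _ hx hy =>
    obtain ⟨s, m, hx⟩ := hx
    obtain ⟨t, l, hy⟩ := hy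
    refine ⟨s + t, m + l, fun i => ?_⟩
    rw [Pi.add_apply, hx, hy, Pi.add_apply]
    push_cast
    ring
  | neg x _ hx =>
    obtain ⟨s, m, hx⟩ := hx
    refine ⟨-s, -m, fun i => ?_⟩
    rw [Pi.neg_apply, hx, Pi.neg_apply]
    push_cast
    ring

theorem injective_natCast_zmod (d : ℕ) :
    Function.Injective fun j : Fin d => ((j : ℕ) : ZMod d) := by
  intro a b hab
  have := (ZMod.natCast_eq_natCast_iff' _ _ _).1 hab
  rw [Nat.mod_eq_of_lt a.2, Nat.mod_eq_of_lt b.2] at this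
  exact Fin.ext this

/-- Membership of `w_{τ'} + k (w_τ - w_σ)` in `W_Φ + Δ_Φ` forces
`i ↦ τ'⁻¹ i + k (τ⁻¹ i - σ⁻¹ i)` to be injective modulo `d`. -/
theorem injective_of_mem_range_wPhi_add {n : ℕ} {Φ : SimplexSet (n + 1)}
    {h : (Fin (n + 1) → ℝ) →ₗ[ℝ] (Fin (n + 1) → ℝ)} (hh : IsDistortion Φ h)
    {τ σ τ' : Equiv.Perm (Fin (n + 1))} {k : ℕ}
    (hmem : wPhi Φ h τ' + (k : ℝ) • (wPhi Φ h τ - wPhi Φ h σ) ∈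
      Set.range (wPhi Φ h) + (latticeOfSS Φ : Set (Fin (n + 1) → ℝ))) :
    Function.Injective fun i : Fin (n + 1) =>
      ((τ'.symm i : ℕ) : ZMod (n + 1)) +
        k * (((τ.symm i : ℕ) : ZMod (n + 1)) - ((σ.symm i : ℕ) : ZMod (n + 1))) := by
  have himg := hh.image_smul
  set H := covolSS Φ ^ ((1 : ℝ) / ((n + 1 : ℕ) - 1 : ℝ)) • h
  have hw : ∀ ρ, wPhi Φ h ρ = H (wStar (n + 1) ρ) := fun ρ => rfl
  have hd := n.succ_ne_zero
  obtain ⟨_, ⟨ρ, rfl⟩, y, hy, hsum⟩ := Set.mem_add.1 hmem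
  have hlat : latticeOfSS Φ
      = (AddSubgroup.closure (Set.range (bstar (n + 1)))).map H.toAddMonoidHom := by
    rw [AddMonoidHom.map_closure]
    unfold latticeOfSS
    rw [← himg]
    rfl
  rw [SetLike.mem_coe, hlat] at hy
  obtain ⟨x, hx, rfl⟩ := hy
  have hxV : x ∈ V0sub (n + 1) := by
    have hle : AddSubgroup.closure (Set.range (bstar (n + 1))) ≤
        (V0sub (n + 1)).toAddSubgroup := by
      rw [AddSubgroup.closure_le]
      rintro _ ⟨j, rfl⟩
      exact bstar_mem_V0sub j
    exact hle hx
  have heq : wStar (n + 1) ρ + x = wStar (n + 1) τ' +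
      (k : ℝ) • (wStar (n + 1) τ - wStar (n + 1) σ) := by
    apply injOn_V0sub_of_image_eq himg
    · exact add_mem (wStar_mem_V0sub hd ρ) hxV
    · exact add_mem (wStar_mem_V0sub hd τ') (Submodule.smul_mem _ _
        (sub_mem (wStar_mem_V0sub hd τ) (wStar_mem_V0sub hd σ)))
    · simp only [hw] at hsum
      rw [map_add, map_add, map_smul, map_sub]
      exact hsum
  obtain ⟨s, m, hsm⟩ := exists_int_of_mem_closure_bstar hx
  have hcoord : ∀ i, ((τ'.symm i : ℕ) : ZMod (n + 1)) +
      k * (((τ.symm i : ℕ) : ZMod (n + 1)) - ((σ.symm i : ℕ) : ZMod (n + 1)))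
      = ((ρ.symm i : ℕ) : ZMod (n + 1)) - s := by
    intro i
    have hi := congrFun heq i
    simp only [Pi.add_apply, Pi.smul_apply, Pi.sub_apply, smul_eq_mul, wStar_apply hd, hsm] at hi
    have hint : ((τ'.symm i : ℕ) : ℤ) + k * (((τ.symm i : ℕ) : ℤ) - ((σ.symm i : ℕ) : ℤ))
        = ((ρ.symm i : ℕ) : ℤ) - s + ((n + 1 : ℕ) : ℤ) * m i := by
      have hr : ((τ'.symm i : ℕ) : ℝ) + k * (((τ.symm i : ℕ) : ℝ) - ((σ.symm i : ℕ) : ℝ))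
          = ((ρ.symm i : ℕ) : ℝ) - s + ((n + 1 : ℕ) : ℝ) * m i := by
        linarith
      exact_mod_cast hr
    have hz := congrArg (Int.cast : ℤ → ZMod (n + 1)) hint
    push_cast at hz
    rw [hz]
    have h0 : ((n : ZMod (n + 1)) + 1) = 0 := by exact_mod_cast ZMod.natCast_self (n + 1)
    rw [h0]
    ring
  simp only [hcoord]
  exact (sub_left_injective.comp (injective_natCast_zmod (n + 1))).comp ρ.symm.injective

theorem natCast_finRotate_pow (n m : ℕ) (j : Fin (n + 1)) :
    ((((finRotate (n + 1)) ^ m) j : ℕ) : ZMod (n + 1)) = (j : ℕ) + m := by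
  induction m with
  | zero => simp
  | succ m ih =>
    rw [pow_succ', Equiv.Perm.mul_apply, finRotate_apply, Fin.val_add, ZMod.natCast_mod,
      Nat.cast_add, ih, Fin.val_one', ZMod.natCast_mod]
    push_cast
    ring

/-- If `τ⁻¹ σ` is not a power of the rotation, then `τ⁻¹ - σ⁻¹` is not constant modulo `d`. -/
theorem exists_sub_ne_sub {n : ℕ} {τ σ : Equiv.Perm (Fin (n + 1))}
    (hστ : τ⁻¹ * σ ∉ Subgroup.zpowers (finRotate (n + 1))) :
    ∃ i j : Fin (n + 1),
      ((τ.symm i : ℕ) : ZMod (n + 1)) - ((σ.symm i : ℕ) : ZMod (n + 1)) ≠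
        ((τ.symm j : ℕ) : ZMod (n + 1)) - ((σ.symm j : ℕ) : ZMod (n + 1)) := by
  by_contra! hcon
  apply hστ
  set c : ZMod (n + 1) := ((τ.symm 0 : ℕ) : ZMod (n + 1)) - ((σ.symm 0 : ℕ) : ZMod (n + 1))
  refine Subgroup.mem_zpowers_iff.2 ⟨(c.val : ℤ), ?_⟩
  rw [zpow_natCast]
  ext1 j
  apply injective_natCast_zmod
  have h1 := hcon (σ j) 0
  rw [Equiv.symm_apply_apply, sub_eq_iff_eq_add] at h1
  change ((((finRotate (n + 1)) ^ c.val) j : ℕ) : ZMod (n + 1)) =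
    ((τ.symm (σ j) : ℕ) : ZMod (n + 1))
  rw [natCast_finRotate_pow, h1, ZMod.natCast_zmod_val]
  exact add_comm _ _

theorem stmt14 (d : ℕ) (hd : 2 ≤ d) (Φ : SimplexSet d)
    (h : (Fin d → ℝ) →ₗ[ℝ] (Fin d → ℝ)) (hh : IsDistortion Φ h)
    (τ σ : Equiv.Perm (Fin d)) (hστ : τ⁻¹ * σ ∉ Subgroup.zpowers (finRotate d)) :
    (∃ (τ' : Equiv.Perm (Fin d)) (k : ℕ), 1 ≤ k ∧ k ≤ d - 1 ∧
        wPhi Φ h τ' + (k : ℝ) • (wPhi Φ h τ - wPhi Φ h σ) ∉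
          Set.range (wPhi Φ h) + (latticeOfSS Φ : Set (Fin d → ℝ))) ∧
    (d.Prime → ∀ τ' : Equiv.Perm (Fin d), ∃ k : ℕ, 1 ≤ k ∧ k ≤ d - 1 ∧
        wPhi Φ h τ' + (k : ℝ) • (wPhi Φ h τ - wPhi Φ h σ) ∉
          Set.range (wPhi Φ h) + (latticeOfSS Φ : Set (Fin d → ℝ))) := by
  obtain ⟨n, rfl⟩ : ∃ n, d = n + 1 := ⟨d - 1, by omega⟩
  obtain ⟨i, j, hij⟩ := exists_sub_ne_sub hστ
  have hne : i ≠ j := fun h0 => hij (by rw [h0])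
  set f : Fin (n + 1) → ZMod (n + 1) := fun i =>
    ((τ.symm i : ℕ) : ZMod (n + 1)) - ((σ.symm i : ℕ) : ZMod (n + 1))
  change f i ≠ f j at hij
  constructor
  · have hlt := ZMod.val_lt (f j - f i)
    set a : Fin (n + 1) := ⟨(f j - f i).val, hlt⟩
    have ha' : ((a : ℕ) : ZMod (n + 1)) = f j - f i := ZMod.natCast_zmod_val (f j - f i)
    have ha0 : a ≠ 0 := by
      intro h0
      rw [h0] at ha'
      rw [Fin.val_zero, Nat.cast_zero] at ha'
      exact hij (sub_eq_zero.1 ha'.symm).symm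
    obtain ⟨ρ, hρi, hρj⟩ : ∃ ρ : Equiv.Perm (Fin (n + 1)), ρ i = a ∧ ρ j = 0 := by
      have hsi : Equiv.swap j 0 i ≠ 0 := by
        intro h0
        apply hne
        rw [Equiv.swap_apply_eq_iff] at h0
        simpa using h0
      refine ⟨(Equiv.swap j 0).trans (Equiv.swap (Equiv.swap j 0 i) a), ?_, ?_⟩
      · simp
      · simp [Equiv.swap_apply_of_ne_of_ne hsi.symm ha0.symm]
    refine ⟨ρ.symm, 1, le_rfl, by omega, fun hmem => ?_⟩
    apply hne
    apply injective_of_mem_range_wPhi_add hh hmem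
    change ((ρ i : ℕ) : ZMod (n + 1)) + (1 : ℕ) * f i = ((ρ j : ℕ) : ZMod (n + 1)) + (1 : ℕ) * f j
    rw [hρi, hρj, ha']
    simp
  · intro hp τ'
    have : Fact (n + 1).Prime := ⟨hp⟩
    set k : ZMod (n + 1) :=
      (((τ'.symm i : ℕ) : ZMod (n + 1)) - ((τ'.symm j : ℕ) : ZMod (n + 1))) / (f j - f i)
    have hfne : f j - f i ≠ 0 := sub_ne_zero.2 hij.symm
    have hk0 : k ≠ 0 := by
      refine div_ne_zero (sub_ne_zero.2 fun h0 => hne ?_) hfne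
      exact τ'.symm.injective (injective_natCast_zmod (n + 1) h0)
    have hkf : k * (f j - f i)
        = ((τ'.symm i : ℕ) : ZMod (n + 1)) - ((τ'.symm j : ℕ) : ZMod (n + 1)) :=
      div_mul_cancel₀ _ hfne
    have hkv : k.val ≠ 0 := fun h0 => hk0 ((ZMod.val_eq_zero k).1 h0)
    have hlt := ZMod.val_lt k
    refine ⟨k.val, by omega, by omega, fun hmem => ?_⟩
    apply hne
    apply injective_of_mem_range_wPhi_add hh hmem
    change ((τ'.symm i : ℕ) : ZMod (n + 1)) + (k.val : ℕ) * f i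
      = ((τ'.symm j : ℕ) : ZMod (n + 1)) + (k.val : ℕ) * f j
    rw [ZMod.natCast_zmod_val]
    linear_combination -hkf
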